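/- arXiv:1801.05977 — 3 statements merged into one kernel-verified Lean document; each statement's English description precedes it below -/
import Mathlib

section
/- The function K is integrable on D_c̃, and for every j = (j₁,j₂) ∈ ℤ² its Fourier coefficient satisfies K̂_j = (i/(4√(π c̃))) · (1/β_{j₁}) · [ ∫₀^{c̃} e^{i(β_{j₁} − j₂π/c̃) t} 𝒳(t) dt + ∫₀^{c̃} e^{i(β_{j₁} + j₂π/c̃) t} 𝒳(t) dt ]. -/
open MeasureTheory Complex Real

noncomputable section

def betaCoef (k α : ℝ) (n : ℤ) : ℂ :=
  if |α + (n : ℝ)| ≤ k then ((Real.sqrt (k ^ 2 - (α + (n : ℝ)) ^ 2) : ℝ) : ℂ)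
  else Complex.I * ((Real.sqrt ((α + (n : ℝ)) ^ 2 - k ^ 2) : ℝ) : ℂ)

/-- The α-quasi-periodic Green's function (eigenfunction expansion). -/
def greenG (k α : ℝ) (x : EuclideanSpace ℝ (Fin 2)) : ℂ :=
  (Complex.I / (4 * (π : ℂ))) *
    ∑' n : ℤ, (1 / betaCoef k α n) *
      Complex.exp (Complex.I * ((α + (n : ℝ) : ℝ) : ℂ) * (x 0 : ℂ) +
        Complex.I * betaCoef k α n * ((|x 1| : ℝ) : ℂ))

/-- K(x) = e^{−iαx₁} G(x) 𝒳(|x₂|). -/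
def funK (k α : ℝ) (𝒳 : ℝ → ℝ) (x : EuclideanSpace ℝ (Fin 2)) : ℂ :=
  Complex.exp (-Complex.I * (α : ℂ) * (x 0 : ℂ)) * greenG k α x * ((𝒳 |x 1| : ℝ) : ℂ)

/-- The rectangle D_c̃ = [−π,π] × [−c̃,c̃]. -/
def domD (ct : ℝ) : Set (EuclideanSpace ℝ (Fin 2)) :=
  {x | x 0 ∈ Set.Icc (-π) π ∧ x 1 ∈ Set.Icc (-ct) ct}

/-- The Fourier basis φ_j(x) = (1/(2√(π c̃))) e^{i(j₁x₁ + j₂πx₂/c̃)}. -/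
def fBasis (ct : ℝ) (j : ℤ × ℤ) (x : EuclideanSpace ℝ (Fin 2)) : ℂ :=
  (1 / (2 * Real.sqrt (π * ct)) : ℝ) *
    Complex.exp (Complex.I * ((j.1 : ℂ) * (x 0 : ℂ) + (j.2 : ℂ) * (π : ℂ) * (x 1 : ℂ) / (ct : ℂ)))

/-- The j-th Fourier coefficient ĝ_j = ∫_{D_c̃} g(x) φ_{−j}(x) dx. -/
def fourierCoef (ct : ℝ) (g : EuclideanSpace ℝ (Fin 2) → ℂ) (j : ℤ × ℤ) : ℂ :=
  ∫ x in domD ct, g x * fBasis ct (-j) x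

/-- A series of functions whose `L¹` norms are summable has an integrable sum. -/
theorem integrable_tsum_of_summable_integral_norm {X E ι : Type*} [MeasurableSpace X]
    {μ : Measure X} [NormedAddCommGroup E] [NormedSpace ℝ E] [CompleteSpace E] [Countable ι]
    {F : ι → X → E} (hF : ∀ i, Integrable (F i) μ) (hs : Summable fun i ↦ ∫ x, ‖F i x‖ ∂μ) :
    Integrable (fun x ↦ ∑' i, F i x) μ := by
  have hfin : ∫⁻ x, ∑' i, ‖F i x‖ₑ ∂μ < ⊤ := by
    rw [lintegral_tsum fun i ↦ (hF i).1.enorm]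
    simp_rw [← ofReal_integral_norm_eq_lintegral_enorm (hF _)]
    rw [← ENNReal.ofReal_tsum_of_nonneg (fun i ↦ integral_nonneg fun x ↦ norm_nonneg _) hs]
    exact ENNReal.ofReal_lt_top
  have hsum : ∀ᵐ x ∂μ, Summable fun i ↦ F i x := by
    filter_upwards [ae_lt_top' (AEMeasurable.tsum fun i ↦ (hF i).1.enorm) hfin.ne]
      with x hx
    exact Summable.of_enorm hx.ne
  refine ⟨aestronglyMeasurable_of_tendsto_ae Filter.atTop (f := fun (s : Finset ι) x ↦ ∑ i ∈ s, F i x)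
    (fun s ↦ Finset.aestronglyMeasurable_fun_sum s fun i _ ↦ (hF i).1) ?_, ?_⟩
  · filter_upwards [hsum] with x hx using hx.hasSum
  · refine lt_of_le_of_lt (lintegral_mono fun x ↦ ?_) hfin
    exact enorm_tsum_le_tsum_enorm

/-- The coordinate map from the Euclidean plane to `ℝ × ℝ`. -/
def planeEquiv : EuclideanSpace ℝ (Fin 2) ≃ᵐ ℝ × ℝ :=
  (MeasurableEquiv.toLp 2 (Fin 2 → ℝ)).symm.trans MeasurableEquiv.finTwoArrow

theorem planeEquiv_apply (x : EuclideanSpace ℝ (Fin 2)) : planeEquiv x = (x 0, x 1) := rfl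

theorem measurePreserving_planeEquiv : MeasurePreserving planeEquiv volume volume :=
  (volume_preserving_finTwoArrow ℝ).comp
    (EuclideanSpace.volume_preserving_symm_measurableEquiv_toLp (Fin 2))

theorem domD_eq_preimage (ct : ℝ) :
    domD ct = planeEquiv ⁻¹' (Set.Icc (-π) π ×ˢ Set.Icc (-ct) ct) := rfl

theorem integral_exp_int_mul (m : ℤ) :
    ∫ s in Set.Icc (-π) π, cexp (I * m * (s : ℂ)) = if m = 0 then 2 * (π : ℂ) else 0 := by
  have hpi : -π ≤ π := by linarith [Real.pi_pos]
  rw [integral_Icc_eq_integral_Ioc, ← intervalIntegral.integral_of_le hpi]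
  split_ifs with h
  · subst h
    simp
    ring
  · have hm : I * (m : ℂ) ≠ 0 := mul_ne_zero I_ne_zero (Int.cast_ne_zero.mpr h)
    rw [integral_exp_mul_complex hm, div_eq_zero_iff, sub_eq_zero]
    left
    rw [Complex.exp_eq_exp_iff_exists_int]
    exact ⟨m, by push_cast; ring⟩

theorem continuous_cutoff_exp {𝒳 : ℝ → ℝ} (h𝒳 : Continuous 𝒳) (b w : ℂ) :
    Continuous fun t : ℝ ↦ cexp (I * b * ((|t| : ℝ) : ℂ)) * ((𝒳 |t| : ℝ) : ℂ) *
      cexp (-(I * w * (t : ℂ))) := by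
  fun_prop

/-- Folding the integral of an even amplitude against a plane wave onto the positive half-line. -/
theorem integral_cutoff_exp {𝒳 : ℝ → ℝ} (h𝒳 : Continuous 𝒳) {ct : ℝ} (hct : 0 ≤ ct) (b w : ℂ) :
    ∫ t in Set.Icc (-ct) ct, cexp (I * b * ((|t| : ℝ) : ℂ)) * ((𝒳 |t| : ℝ) : ℂ) *
        cexp (-(I * w * (t : ℂ))) =
      (∫ t in (0 : ℝ)..ct, cexp (I * (b - w) * (t : ℂ)) * ((𝒳 t : ℝ) : ℂ)) +
        ∫ t in (0 : ℝ)..ct, cexp (I * (b + w) * (t : ℂ)) * ((𝒳 t : ℝ) : ℂ) := by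
  have hcont := continuous_cutoff_exp h𝒳 b w
  rw [integral_Icc_eq_integral_Ioc, ← intervalIntegral.integral_of_le (by linarith),
    ← intervalIntegral.integral_add_adjacent_intervals (b := 0)
      (hcont.intervalIntegrable _ _) (hcont.intervalIntegrable _ _), add_comm]
  congr 1
  · refine intervalIntegral.integral_congr fun t ht ↦ ?_
    rw [Set.uIcc_of_le hct] at ht
    simp only [abs_of_nonneg ht.1]
    rw [mul_right_comm, ← Complex.exp_add]
    ring_nf
  · have h := intervalIntegral.integral_comp_neg (a := 0) (b := ct)
      fun t : ℝ ↦ cexp (I * b * ((|t| : ℝ) : ℂ)) * ((𝒳 |t| : ℝ) : ℂ) * cexp (-(I * w * (t : ℂ)))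
    rw [neg_zero] at h
    rw [← h]
    refine intervalIntegral.integral_congr fun t ht ↦ ?_
    rw [Set.uIcc_of_le hct] at ht
    simp only [abs_neg, abs_of_nonneg ht.1]
    rw [mul_right_comm, ← Complex.exp_add]
    push_cast
    ring_nf

theorem integral_norm_cutoff_exp_le {𝒳 : ℝ → ℝ} (h𝒳 : Continuous 𝒳) {ct M b : ℝ} (hb : 0 < b)
    (hM : ∀ t ∈ Set.Icc 0 ct, |𝒳 t| ≤ M) (hM0 : 0 ≤ M) (w : ℝ) :
    ∫ t in Set.Icc (-ct) ct, ‖cexp (I * (I * (b : ℂ)) * ((|t| : ℝ) : ℂ)) * ((𝒳 |t| : ℝ) : ℂ) *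
        cexp (-(I * (w : ℂ) * (t : ℂ)))‖ ≤ M * (2 / b) := by
  have hval : ∫ t : ℝ, Real.exp (-b * |t|) = 2 / b := by
    rw [integral_comp_abs (f := fun t ↦ Real.exp (-b * t)), integral_exp_mul_Ioi (by linarith)]
    simp
    ring
  have hexp : Integrable fun t : ℝ ↦ Real.exp (-b * |t|) :=
    .of_integral_ne_zero (hval ▸ (by positivity))
  have hint := hexp.const_mul M
  calc _ ≤ ∫ t in Set.Icc (-ct) ct, M * Real.exp (-b * |t|) := by
        refine setIntegral_mono_on
          ((continuous_cutoff_exp h𝒳 _ _).norm.integrableOn_Icc) hint.integrableOn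
          measurableSet_Icc fun t ht ↦ ?_
        have h1 : I * (I * (b : ℂ)) * ((|t| : ℝ) : ℂ) = ((-b * |t| : ℝ) : ℂ) := by
          push_cast
          linear_combination (b : ℂ) * ((|t| : ℝ) : ℂ) * I_mul_I
        have h2 : -(I * (w : ℂ) * (t : ℂ)) = ((-(w * t) : ℝ) : ℂ) * I := by
          push_cast
          ring
        rw [h1, h2, norm_mul, norm_mul, Complex.norm_exp_ofReal_mul_I, mul_one,
          Complex.norm_exp_ofReal, mul_comm, Complex.norm_real, Real.norm_eq_abs]
        exact mul_le_mul_of_nonneg_right (hM _ ⟨abs_nonneg t, abs_le.mpr ht⟩) (Real.exp_nonneg _)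
    _ ≤ ∫ t : ℝ, M * Real.exp (-b * |t|) :=
        setIntegral_le_integral hint
          (Filter.Eventually.of_forall fun t ↦ mul_nonneg hM0 (Real.exp_nonneg _))
    _ = M * (2 / b) := by rw [integral_const_mul, hval]

/-- Far out in the spectrum all modes are evanescent, with a decay rate comparable to the index. -/
theorem eventually_betaCoef_eq {k : ℝ} (hk : 0 < k) (α : ℝ) :
    ∀ᶠ n : ℤ in Filter.cofinite, ∃ b : ℝ, 0 < b ∧ betaCoef k α n = I * (b : ℂ) ∧
      1 / b ^ 2 ≤ 2 * (1 / |(n : ℝ) + α| ^ (2 : ℝ)) := by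
  have htend : Filter.Tendsto (fun n : ℤ ↦ |(n : ℝ) + α|) Filter.cofinite Filter.atTop :=
    (tendsto_norm_cocompact_atTop (E := ℝ)).comp
      ((Homeomorph.addRight α).isClosedEmbedding.tendsto_cocompact.comp Int.tendsto_coe_cofinite)
  filter_upwards [htend.eventually_ge_atTop (2 * k)] with n hn
  have hn' : 2 * k ≤ |α + (n : ℝ)| := by rwa [add_comm]
  have hsq : 4 * k ^ 2 ≤ (α + (n : ℝ)) ^ 2 := by
    rw [← sq_abs (α + (n : ℝ))]
    nlinarith
  have hpos : 0 < (α + (n : ℝ)) ^ 2 - k ^ 2 := by nlinarith [pow_pos hk 2]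
  refine ⟨√((α + (n : ℝ)) ^ 2 - k ^ 2), Real.sqrt_pos.mpr hpos, ?_, ?_⟩
  · rw [betaCoef, if_neg (by linarith)]
  · rw [Real.sq_sqrt hpos.le, Real.rpow_two, sq_abs, add_comm (n : ℝ) α, mul_one_div,
      div_le_div_iff₀ hpos (by nlinarith [pow_pos hk 2])]
    nlinarith [pow_pos hk 2]

/-- The contribution of the `n`-th mode of the Green's function to `K φ_{-j}`, in coordinates. -/
def modeTerm (k α ct : ℝ) (𝒳 : ℝ → ℝ) (j : ℤ × ℤ) (n : ℤ) (z : ℝ × ℝ) : ℂ :=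
  (I / (4 * (π : ℂ)) * ((1 / (2 * √(π * ct)) : ℝ) : ℂ) * (1 / betaCoef k α n) *
      cexp (I * ((n - j.1 : ℤ) : ℂ) * (z.1 : ℂ))) *
    (cexp (I * betaCoef k α n * ((|z.2| : ℝ) : ℂ)) * ((𝒳 |z.2| : ℝ) : ℂ) *
      cexp (-(I * ((j.2 * π / ct : ℝ) : ℂ) * (z.2 : ℂ))))

theorem funK_mul_fBasis (k α ct : ℝ) (𝒳 : ℝ → ℝ) (j : ℤ × ℤ) (x : EuclideanSpace ℝ (Fin 2)) :
    funK k α 𝒳 x * fBasis ct (-j) x = ∑' n, modeTerm k α ct 𝒳 j n (planeEquiv x) := by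
  rw [planeEquiv_apply, funK, greenG, fBasis, ← mul_assoc, ← tsum_mul_left, ← tsum_mul_left,
    ← tsum_mul_right, ← tsum_mul_right, ← tsum_mul_right]
  refine tsum_congr fun n ↦ ?_
  have e1 : cexp (-I * (α : ℂ) * (x 0 : ℂ)) *
      cexp (I * ((α + (n : ℝ) : ℝ) : ℂ) * (x 0 : ℂ) + I * betaCoef k α n * ((|x 1| : ℝ) : ℂ)) *
      cexp (I * (((-j).1 : ℂ) * (x 0 : ℂ) + ((-j).2 : ℂ) * (π : ℂ) * (x 1 : ℂ) / (ct : ℂ))) =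
      cexp (I * ((n - j.1 : ℤ) : ℂ) * (x 0 : ℂ)) * cexp (I * betaCoef k α n * ((|x 1| : ℝ) : ℂ)) *
      cexp (-(I * ((j.2 * π / ct : ℝ) : ℂ) * (x 1 : ℂ))) := by
    simp only [← Complex.exp_add, Prod.fst_neg, Prod.snd_neg]
    push_cast
    ring_nf
  rw [modeTerm]
  linear_combination (I / (4 * (π : ℂ)) * ((1 / (2 * √(π * ct)) : ℝ) : ℂ) *
    (1 / betaCoef k α n) * ((𝒳 |x 1| : ℝ) : ℂ)) * e1

theorem integrableOn_modeTerm {𝒳 : ℝ → ℝ} (h𝒳 : Continuous 𝒳) (k α ct : ℝ) (j : ℤ × ℤ) (n : ℤ) :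
    IntegrableOn (modeTerm k α ct 𝒳 j n) (Set.Icc (-π) π ×ˢ Set.Icc (-ct) ct) := by
  refine Continuous.continuousOn ?_ |>.integrableOn_compact (isCompact_Icc.prod isCompact_Icc)
  unfold modeTerm
  fun_prop

theorem setIntegral_modeTerm {𝒳 : ℝ → ℝ} (h𝒳 : Continuous 𝒳) {ct : ℝ} (hct : 0 ≤ ct)
    (k α : ℝ) (j : ℤ × ℤ) (n : ℤ) :
    ∫ z in Set.Icc (-π) π ×ˢ Set.Icc (-ct) ct, modeTerm k α ct 𝒳 j n z =
      I / (4 * (π : ℂ)) * ((1 / (2 * √(π * ct)) : ℝ) : ℂ) * (1 / betaCoef k α n) *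
        (if n - j.1 = 0 then 2 * (π : ℂ) else 0) *
        ((∫ t in (0 : ℝ)..ct, cexp (I * (betaCoef k α n - ((j.2 * π / ct : ℝ) : ℂ)) * (t : ℂ)) *
            ((𝒳 t : ℝ) : ℂ)) +
          ∫ t in (0 : ℝ)..ct, cexp (I * (betaCoef k α n + ((j.2 * π / ct : ℝ) : ℂ)) * (t : ℂ)) *
            ((𝒳 t : ℝ) : ℂ)) := by
  refine (setIntegral_prod_mul (μ := volume) (ν := volume)
    (fun s : ℝ ↦ I / (4 * (π : ℂ)) * ((1 / (2 * √(π * ct)) : ℝ) : ℂ) * (1 / betaCoef k α n) *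
      cexp (I * ((n - j.1 : ℤ) : ℂ) * (s : ℂ)))
    (fun t : ℝ ↦ cexp (I * betaCoef k α n * ((|t| : ℝ) : ℂ)) * ((𝒳 |t| : ℝ) : ℂ) *
      cexp (-(I * ((j.2 * π / ct : ℝ) : ℂ) * (t : ℂ)))) _ _).trans ?_
  rw [integral_cutoff_exp h𝒳 hct, integral_const_mul, integral_exp_int_mul]

theorem setIntegral_norm_modeTerm (𝒳 : ℝ → ℝ) (k α ct : ℝ) (j : ℤ × ℤ) (n : ℤ) :
    ∫ z in Set.Icc (-π) π ×ˢ Set.Icc (-ct) ct, ‖modeTerm k α ct 𝒳 j n z‖ =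
      ‖I / (4 * (π : ℂ)) * ((1 / (2 * √(π * ct)) : ℝ) : ℂ)‖ * ‖1 / betaCoef k α n‖ * (2 * π) *
        ∫ t in Set.Icc (-ct) ct, ‖cexp (I * betaCoef k α n * ((|t| : ℝ) : ℂ)) *
          ((𝒳 |t| : ℝ) : ℂ) * cexp (-(I * ((j.2 * π / ct : ℝ) : ℂ) * (t : ℂ)))‖ := by
  have hu (s : ℝ) : ‖cexp (I * ((n - j.1 : ℤ) : ℂ) * (s : ℂ))‖ = 1 := by
    rw [show I * ((n - j.1 : ℤ) : ℂ) * (s : ℂ) = (((n - j.1 : ℤ) * s : ℝ) : ℂ) * I by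
      push_cast; ring, Complex.norm_exp_ofReal_mul_I]
  simp only [modeTerm, norm_mul _ (_ * cexp _), norm_mul _ (cexp (I * ((n - j.1 : ℤ) : ℂ) * _)), hu,
    norm_mul (_ * _) (1 / betaCoef k α n)]
  refine (setIntegral_prod_mul (μ := volume) (ν := volume)
    (fun _ : ℝ ↦ ‖I / (4 * (π : ℂ)) * ((1 / (2 * √(π * ct)) : ℝ) : ℂ)‖ * ‖1 / betaCoef k α n‖ * 1)
    (fun t : ℝ ↦ ‖cexp (I * betaCoef k α n * ((|t| : ℝ) : ℂ)) * ((𝒳 |t| : ℝ) : ℂ) *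
      cexp (-(I * ((j.2 * π / ct : ℝ) : ℂ) * (t : ℂ)))‖) _ _).trans ?_
  rw [setIntegral_const, Real.volume_real_Icc_of_le (by linarith [Real.pi_pos]), smul_eq_mul]
  ring

theorem summable_setIntegral_norm_modeTerm {𝒳 : ℝ → ℝ} (h𝒳 : Continuous 𝒳) {k : ℝ} (hk : 0 < k)
    (α ct : ℝ) (j : ℤ × ℤ) :
    Summable fun n ↦ ∫ z in Set.Icc (-π) π ×ˢ Set.Icc (-ct) ct, ‖modeTerm k α ct 𝒳 j n z‖ := by
  obtain ⟨M, hM⟩ := isCompact_Icc.exists_bound_of_continuousOn (s := Set.Icc 0 ct) h𝒳.continuousOn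
  have hM' : ∀ t ∈ Set.Icc 0 ct, |𝒳 t| ≤ max M 0 := fun t ht ↦ (hM t ht).trans (le_max_left _ _)
  set A := ‖I / (4 * (π : ℂ)) * ((1 / (2 * √(π * ct)) : ℝ) : ℂ)‖ with hA
  have hs : Summable fun n : ℤ ↦
      A * (2 * π) * (max M 0 * 2) * (2 * (1 / |(n : ℝ) + α| ^ (2 : ℝ))) :=
    (((Real.summable_one_div_int_add_rpow α 2).mpr one_lt_two).mul_left _).mul_left _
  refine Summable.of_norm_bounded_eventually hs ?_
  filter_upwards [eventually_betaCoef_eq hk α] with n ⟨b, hb, hβ, hle⟩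
  rw [Real.norm_of_nonneg (integral_nonneg fun _ ↦ norm_nonneg _), setIntegral_norm_modeTerm, ← hA,
    hβ]
  have hI := integral_norm_cutoff_exp_le h𝒳 hb hM' (le_max_right _ _) (j.2 * π / ct)
  have hnorm : ‖1 / (I * (b : ℂ))‖ = 1 / b := by
    simp [abs_of_pos hb]
  rw [hnorm]
  have hA0 : 0 ≤ A := norm_nonneg _
  have hM0 : 0 ≤ max M 0 := le_max_right _ _
  have hpi := Real.pi_pos
  calc _ ≤ A * (1 / b) * (2 * π) * (max M 0 * (2 / b)) := by gcongr
    _ = A * (2 * π) * (max M 0 * 2) * (1 / b ^ 2) := by field_simp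
    _ ≤ _ := by gcongr

/-- K is integrable on D_c̃ and its Fourier coefficients are given by
K̂_j = (i/(4√(πc̃))) (1/β_{j₁}) [∫₀^{c̃} e^{i(β_{j₁}−j₂π/c̃)t}𝒳(t)dt
+ ∫₀^{c̃} e^{i(β_{j₁}+j₂π/c̃)t}𝒳(t)dt]. -/
theorem statement2 (k α c ct : ℝ) (hk : 0 < k) (hc : 0 < c) (hcct : c < ct)
    (hβ : ∀ n : ℤ, betaCoef k α n ≠ 0)
    (𝒳 : ℝ → ℝ) (h𝒳 : ContDiff ℝ (⊤ : ℕ∞) 𝒳)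
    (h𝒳1 : ∀ t : ℝ, |t| ≤ c → 𝒳 t = 1)
    (h𝒳0 : ∀ t : ℝ, (c + ct) / 2 ≤ |t| → 𝒳 t = 0) :
    IntegrableOn (funK k α 𝒳) (domD ct) volume ∧
      ∀ j : ℤ × ℤ,
        fourierCoef ct (funK k α 𝒳) j =
          (Complex.I / (4 * (Real.sqrt (π * ct) : ℂ))) * (1 / betaCoef k α j.1) *
            ((∫ t in (0 : ℝ)..ct,
                Complex.exp (Complex.I * (betaCoef k α j.1 - (j.2 : ℂ) * (π : ℂ) / (ct : ℂ)) * (t : ℂ)) *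
                  ((𝒳 t : ℝ) : ℂ)) +
              (∫ t in (0 : ℝ)..ct,
                Complex.exp (Complex.I * (betaCoef k α j.1 + (j.2 : ℂ) * (π : ℂ) / (ct : ℂ)) * (t : ℂ)) *
                  ((𝒳 t : ℝ) : ℂ))) := by
  have hct : 0 < ct := hc.trans hcct
  have hX := h𝒳.continuous
  have hF (j : ℤ × ℤ) := fun n ↦ integrableOn_modeTerm hX k α ct j n
  have hs (j : ℤ × ℤ) := summable_setIntegral_norm_modeTerm hX hk α ct j
  have hsqrt : ((√(π * ct) : ℝ) : ℂ) ≠ 0 :=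
    Complex.ofReal_ne_zero.mpr (Real.sqrt_pos.mpr (mul_pos Real.pi_pos hct)).ne'
  refine ⟨?_, fun j ↦ ?_⟩
  · have h : IntegrableOn (fun x ↦ funK k α 𝒳 x * fBasis ct (-0) x) (domD ct) := by
      simp_rw [funK_mul_fBasis, domD_eq_preimage]
      exact (measurePreserving_planeEquiv.integrableOn_comp_preimage
        planeEquiv.measurableEmbedding).mpr
        (integrable_tsum_of_summable_integral_norm (hF 0) (hs 0))
    refine IntegrableOn.congr_fun (h.mul_const (2 * √(π * ct) : ℂ)) (fun x _ ↦ ?_) ?_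
    · simp [fBasis]
      field_simp
    · exact planeEquiv.measurable (measurableSet_Icc.prod measurableSet_Icc)
  · have hint : fourierCoef ct (funK k α 𝒳) j =
        ∫ z in Set.Icc (-π) π ×ˢ Set.Icc (-ct) ct, ∑' n, modeTerm k α ct 𝒳 j n z := by
      simp_rw [fourierCoef, funK_mul_fBasis, domD_eq_preimage]
      exact measurePreserving_planeEquiv.setIntegral_preimage_emb
        planeEquiv.measurableEmbedding (fun z ↦ ∑' n, modeTerm k α ct 𝒳 j n z) _
    rw [hint, ← integral_tsum_of_summable_integral_norm (hF j) (hs j),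
      tsum_eq_single j.1 fun n hn ↦ by
        rw [setIntegral_modeTerm hX hct.le, if_neg (sub_ne_zero.mpr hn)]; ring,
      setIntegral_modeTerm hX hct.le, if_pos (sub_self _)]
    push_cast
    congr 1
    have hpi : (π : ℂ) ≠ 0 := Complex.ofReal_ne_zero.mpr Real.pi_ne_zero
    field_simp

end
end

section
/- The function K_d is integrable on D_{dc̃}, and for every j = (j₁,j₂,j₃) ∈ ℤ³ its Fourier coefficient satisfies K̂_{dj} = (i/(2√(8π²c̃))) · (1/β_{j₁,j₂}) · ∫₀^{c̃} [ e^{i(β_{j₁,j₂} − j₃π/c̃) x₃} + e^{i(β_{j₁,j₂} + j₃π/c̃) x₃} ] 𝒳(x₃) dx₃. -/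
open MeasureTheory Complex Real

noncomputable section

/-- β_{n₁,n₂} from the eigenfunction expansion of the 3D doubly quasi-periodic
Green's function. -/
def betaCoef3 (k α₁ α₂ : ℝ) (n : ℤ × ℤ) : ℂ :=
  if (α₁ + (n.1 : ℝ)) ^ 2 + (α₂ + (n.2 : ℝ)) ^ 2 ≤ k ^ 2 then
    ((Real.sqrt (k ^ 2 - (α₁ + (n.1 : ℝ)) ^ 2 - (α₂ + (n.2 : ℝ)) ^ 2) : ℝ) : ℂ)
  else Complex.I * ((Real.sqrt ((α₁ + (n.1 : ℝ)) ^ 2 + (α₂ + (n.2 : ℝ)) ^ 2 - k ^ 2) : ℝ) : ℂ)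

/-- The doubly quasi-periodic Green's function (eigenfunction expansion). -/
def greenGd (k α₁ α₂ : ℝ) (x : EuclideanSpace ℝ (Fin 3)) : ℂ :=
  (Complex.I / (8 * (π : ℂ) ^ 2)) *
    ∑' n : ℤ × ℤ, (1 / betaCoef3 k α₁ α₂ n) *
      Complex.exp (Complex.I * ((α₁ + (n.1 : ℝ) : ℝ) : ℂ) * (x 0 : ℂ) +
        Complex.I * ((α₂ + (n.2 : ℝ) : ℝ) : ℂ) * (x 1 : ℂ) +
        Complex.I * betaCoef3 k α₁ α₂ n * ((|x 2| : ℝ) : ℂ))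

/-- K_d(x) = e^{−iα₁x₁−iα₂x₂} G_d(x) 𝒳(|x₃|). -/
def funKd (k α₁ α₂ : ℝ) (𝒳 : ℝ → ℝ) (x : EuclideanSpace ℝ (Fin 3)) : ℂ :=
  Complex.exp (-Complex.I * (α₁ : ℂ) * (x 0 : ℂ) - Complex.I * (α₂ : ℂ) * (x 1 : ℂ)) *
    greenGd k α₁ α₂ x * ((𝒳 |x 2| : ℝ) : ℂ)

/-- The box D_{dc̃} = [−π,π]² × [−c̃,c̃]. -/
def domDd (ct : ℝ) : Set (EuclideanSpace ℝ (Fin 3)) :=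
  {x | x 0 ∈ Set.Icc (-π) π ∧ x 1 ∈ Set.Icc (-π) π ∧ x 2 ∈ Set.Icc (-ct) ct}

/-- The Fourier basis φ_j(x) = (1/√(8π²c̃)) e^{i(j₁x₁ + j₂x₂ + j₃πx₃/c̃)}. -/
def fBasis3 (ct : ℝ) (j : ℤ × ℤ × ℤ) (x : EuclideanSpace ℝ (Fin 3)) : ℂ :=
  (1 / Real.sqrt (8 * π ^ 2 * ct) : ℝ) *
    Complex.exp (Complex.I * ((j.1 : ℂ) * (x 0 : ℂ) + (j.2.1 : ℂ) * (x 1 : ℂ) +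
      (j.2.2 : ℂ) * (π : ℂ) * (x 2 : ℂ) / (ct : ℂ)))

/-- The j-th Fourier coefficient ĝ_j = ∫_{D_{dc̃}} g(x) φ_{−j}(x) dx. -/
def fourierCoef3 (ct : ℝ) (g : EuclideanSpace ℝ (Fin 3) → ℂ) (j : ℤ × ℤ × ℤ) : ℂ :=
  ∫ x in domDd ct, g x * fBasis3 ct (-j) x

/-- The intervals of which the box `domDd ct` is the product. -/
def boxSide (ct : ℝ) : Fin 3 → Set ℝ :=
  ![Set.Icc (-π) π, Set.Icc (-π) π, Set.Icc (-ct) ct]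

theorem measurePreserving_ofLp_domDd (ct : ℝ) :
    MeasurePreserving (fun x : EuclideanSpace ℝ (Fin 3) => x.ofLp)
      (volume.restrict (domDd ct)) (Measure.pi fun i => volume.restrict (boxSide ct i)) := by
  have hpre : domDd ct =
      (fun x : EuclideanSpace ℝ (Fin 3) => x.ofLp) ⁻¹' (Set.univ.pi (boxSide ct)) := by
    ext x
    simp [domDd, boxSide, Fin.forall_fin_succ]
  have hmeas : MeasurableSet (Set.univ.pi (boxSide ct)) := by
    refine MeasurableSet.univ_pi fun i => ?_
    fin_cases i <;> exact measurableSet_Icc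
  rw [hpre, ← Measure.restrict_pi_pi]
  exact (PiLp.volume_preserving_ofLp (Fin 3)).restrict_preimage hmeas

instance isFiniteMeasure_boxSide (ct : ℝ) (i : Fin 3) :
    IsFiniteMeasure (volume.restrict (boxSide ct i)) := by
  fin_cases i <;> exact inferInstanceAs (IsFiniteMeasure (volume.restrict (Set.Icc _ _)))

instance isFiniteMeasure_domDd (ct : ℝ) :
    IsFiniteMeasure ((volume : Measure (EuclideanSpace ℝ (Fin 3))).restrict (domDd ct)) :=
  ⟨by
    have h := (measurePreserving_ofLp_domDd ct).measure_preimage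
      (s := Set.univ) nullMeasurableSet_univ
    rw [Set.preimage_univ] at h
    rw [h]
    exact measure_lt_top _ _⟩

theorem ae_domDd_ne_zero (ct : ℝ) :
    ∀ᵐ x : EuclideanSpace ℝ (Fin 3) ∂volume.restrict (domDd ct), x 2 ≠ 0 := by
  have h := (measurePreserving_ofLp_domDd ct).quasiMeasurePreserving.ae
    (p := fun y : Fin 3 → ℝ => y 2 ≠ 0) ?_
  · exact h
  · have : NullSingletonClass (volume.restrict (boxSide ct 2)) :=
      inferInstanceAs (NullSingletonClass ((volume : Measure ℝ).restrict (Set.Icc (-ct) ct)))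
    rw [ae_iff]
    simpa using Measure.pi_hyperplane (fun i => volume.restrict (boxSide ct i)) (2 : Fin 3) 0

theorem ae_domDd_mem_Icc (ct : ℝ) :
    ∀ᵐ x : EuclideanSpace ℝ (Fin 3) ∂volume.restrict (domDd ct), x 2 ∈ Set.Icc (-ct) ct := by
  refine ae_restrict_of_forall_mem ?_ fun x hx => hx.2.2
  have : domDd ct = (fun x : EuclideanSpace ℝ (Fin 3) => x 0) ⁻¹' Set.Icc (-π) π ∩
      ((fun x => x 1) ⁻¹' Set.Icc (-π) π ∩ (fun x => x 2) ⁻¹' Set.Icc (-ct) ct) := rfl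
  rw [this]
  have hm (i : Fin 3) : Measurable fun x : EuclideanSpace ℝ (Fin 3) => x i := by fun_prop
  exact (hm 0 measurableSet_Icc).inter ((hm 1 measurableSet_Icc).inter (hm 2 measurableSet_Icc))

theorem setIntegral_domDd_mul (ct : ℝ) (g₀ g₁ g₂ : ℝ → ℂ) :
    ∫ x in domDd ct, g₀ (x 0) * g₁ (x 1) * g₂ (x 2) =
      (∫ t in Set.Icc (-π) π, g₀ t) * (∫ t in Set.Icc (-π) π, g₁ t) *
        ∫ t in Set.Icc (-ct) ct, g₂ t := by
  have h := (measurePreserving_ofLp_domDd ct).integral_comp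
    (MeasurableEquiv.toLp 2 (Fin 3 → ℝ)).symm.measurableEmbedding
    (fun y => g₀ (y 0) * g₁ (y 1) * g₂ (y 2))
  have h' := integral_fintype_prod_eq_prod (𝕜 := ℂ) ![g₀, g₁, g₂]
    (μ := fun i => volume.restrict (boxSide ct i))
  simp only [Fin.prod_univ_three] at h'
  exact h.trans h'

theorem setIntegral_exp_int_mul_I (m : ℤ) :
    ∫ t in Set.Icc (-π) π, Complex.exp (m * (t : ℂ) * I) = if m = 0 then 2 * (π : ℂ) else 0 := by
  rw [integral_Icc_eq_integral_Ioc,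
    ← intervalIntegral.integral_of_le (by linarith [Real.pi_pos])]
  split_ifs with hm
  · simp [hm]
    ring
  · have hc : (m : ℂ) * I ≠ 0 := by simp [hm]
    have h := integral_exp_mul_complex (a := -π) (b := π) hc
    simp_rw [show ∀ t : ℝ, (m : ℂ) * (t : ℂ) * I = m * I * t from fun t => by ring]
    rw [h, div_eq_zero_iff, sub_eq_zero]
    left
    rw [Complex.exp_eq_exp_iff_exists_int]
    exact ⟨m, by push_cast; ring⟩

/-- The function `x ↦ e^{i (n₁ x₁ + n₂ x₂)} h(x₃)`. -/
def planeMode (n : ℤ × ℤ) (h : ℝ → ℂ) (x : EuclideanSpace ℝ (Fin 3)) : ℂ :=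
  Complex.exp (n.1 * (x 0 : ℂ) * I) * Complex.exp (n.2 * (x 1 : ℂ) * I) * h (x 2)

theorem norm_planeMode (n : ℤ × ℤ) (h : ℝ → ℂ) (x : EuclideanSpace ℝ (Fin 3)) :
    ‖planeMode n h x‖ = ‖h (x 2)‖ := by
  simp [planeMode, Complex.norm_exp]

theorem setIntegral_conj_planeMode_mul (ct : ℝ) (m n : ℤ × ℤ) (f g : ℝ → ℂ) :
    ∫ x in domDd ct, planeMode n g x * starRingEnd ℂ (planeMode m f x) =
      if m = n then 4 * (π : ℂ) ^ 2 * ∫ t in Set.Icc (-ct) ct, g t * starRingEnd ℂ (f t)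
      else 0 := by
  let e (p : ℤ) (t : ℝ) : ℂ := Complex.exp (p * (t : ℂ) * I)
  have he (p q : ℤ) (t : ℝ) : e p t * starRingEnd ℂ (e q t) = e (p - q) t := by
    simp only [e, ← Complex.exp_conj, ← Complex.exp_add, map_mul, Complex.conj_I,
      Complex.conj_ofReal, map_intCast]
    congr 1
    push_cast
    ring
  have h (x : EuclideanSpace ℝ (Fin 3)) :
      planeMode n g x * starRingEnd ℂ (planeMode m f x) =
        e (n.1 - m.1) (x 0) * e (n.2 - m.2) (x 1) * (g (x 2) * starRingEnd ℂ (f (x 2))) := by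
    rw [← he, ← he]
    simp only [planeMode, map_mul, e]
    ring
  simp_rw [h]
  rw [setIntegral_domDd_mul ct (e _) (e _) fun t => g t * starRingEnd ℂ (f t),
    setIntegral_exp_int_mul_I, setIntegral_exp_int_mul_I]
  simp only [sub_eq_zero]
  by_cases h1 : n.1 = m.1 <;> by_cases h2 : n.2 = m.2
  · have : m = n := Prod.ext h1.symm h2.symm
    rw [if_pos h1, if_pos h2, if_pos this]
    ring
  · simp [h2, show m ≠ n from fun h => h2 (h ▸ rfl)]
  · simp [h1, show m ≠ n from fun h => h1 (h ▸ rfl)]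
  · simp [h1, show m ≠ n from fun h => h1 (h ▸ rfl)]

theorem memLp_planeMode (ct : ℝ) (n : ℤ × ℤ) {h : ℝ → ℂ} (hh : Continuous h) :
    MemLp (planeMode n h) 2 (volume.restrict (domDd ct)) := by
  obtain ⟨C, hC⟩ := (isCompact_Icc (a := -ct) (b := ct)).exists_bound_of_continuousOn
    hh.continuousOn
  refine MemLp.of_bound (Continuous.aestronglyMeasurable ?_) C ?_
  · unfold planeMode
    fun_prop
  · filter_upwards [ae_domDd_mem_Icc ct] with x hx
    rw [norm_planeMode]
    exact hC _ hx

theorem summable_of_pairwise_inner_eq_zero {ι E : Type*} [NormedAddCommGroup E]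
    [InnerProductSpace ℂ E] [CompleteSpace E] {v : ι → E}
    (hv : Pairwise fun i j => inner ℂ (v i) (v j) = 0) (hs : Summable fun i => ‖v i‖ ^ 2) :
    Summable v := by
  have hV : OrthogonalFamily ℂ (fun i => Submodule.span ℂ {v i})
      fun i => (Submodule.span ℂ {v i}).subtypeₗᵢ :=
    OrthogonalFamily.of_pairwise fun i j hij => by
      simpa [Function.onFun, Submodule.isOrtho_span] using hv hij
  exact (hV.summable_iff_norm_sq_summable
    fun i => ⟨v i, Submodule.mem_span_singleton_self _⟩).2 hs

theorem planeMode_series (ct : ℝ) {h : ℤ × ℤ → ℝ → ℂ} (hh : ∀ n, Continuous (h n))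
    (hs : Summable fun n => ‖∫ t in Set.Icc (-ct) ct, h n t * starRingEnd ℂ (h n t)‖)
    {K : EuclideanSpace ℝ (Fin 3) → ℂ}
    (hK : ∀ x, x 2 ≠ 0 → HasSum (fun n => planeMode n (h n) x) (K x)) :
    MemLp K 2 (volume.restrict (domDd ct)) ∧
      ∀ n (g : ℝ → ℂ), Continuous g →
        ∫ x in domDd ct, K x * starRingEnd ℂ (planeMode n g x) =
          4 * (π : ℂ) ^ 2 * ∫ t in Set.Icc (-ct) ct, h n t * starRingEnd ℂ (g t) := by
  set μ := (volume : Measure (EuclideanSpace ℝ (Fin 3))).restrict (domDd ct) with hμ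
  have inner_toLp {f g : EuclideanSpace ℝ (Fin 3) → ℂ} (hf : MemLp f 2 μ) (hg : MemLp g 2 μ) :
      inner ℂ (hf.toLp f) (hg.toLp g) = ∫ x, g x * starRingEnd ℂ (f x) ∂μ := by
    rw [L2.inner_def]
    refine integral_congr_ae ?_
    filter_upwards [hf.coeFn_toLp, hg.coeFn_toLp] with x hx hx'
    rw [hx, hx', RCLike.inner_apply]
  have hm n : MemLp (planeMode n (h n)) 2 μ := memLp_planeMode ct n (hh n)
  let v n : Lp ℂ 2 μ := (hm n).toLp _
  have hsum : Summable v := by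
    refine summable_of_pairwise_inner_eq_zero (fun i j hij => ?_) ?_
    · simp only [v]
      rw [inner_toLp, hμ, setIntegral_conj_planeMode_mul, if_neg hij]
    · refine (hs.mul_left (4 * π ^ 2)).congr fun n => ?_
      have : ‖inner ℂ (v n) (v n)‖ = ‖v n‖ ^ 2 := by
        rw [inner_self_eq_norm_sq_to_K]
        simp
      rw [← this]
      simp only [v]
      rw [inner_toLp, hμ, setIntegral_conj_planeMode_mul, if_pos rfl]
      simp [abs_of_pos Real.pi_pos]
  have hF := hsum.hasSum
  set F := ∑' n, v n
  have hKF : F =ᵐ[μ] K := by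
    obtain ⟨s, hs⟩ := (Filter.atTop : Filter (Finset (ℤ × ℤ))).exists_seq_tendsto
    have hlim : Filter.Tendsto (fun N => ∑ n ∈ s N, v n) Filter.atTop (nhds F) := hF.comp hs
    obtain ⟨φ, hφ, hae⟩ := (tendstoInMeasure_of_tendsto_Lp hlim).exists_seq_tendsto_ae
    have hcoe : ∀ᵐ x ∂μ, ∀ N, (∑ n ∈ s N, v n : Lp ℂ 2 μ) x =
        ∑ n ∈ s N, planeMode n (h n) x := by
      have hv : ∀ᵐ x ∂μ, ∀ n, v n x = planeMode n (h n) x :=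
        ae_all_iff.2 fun n => (hm n).coeFn_toLp
      refine ae_all_iff.2 fun N => ?_
      filter_upwards [hv, Lp.coeFn_finsetSum (s N) v] with x hx hx'
      rw [hx', Finset.sum_apply]
      exact Finset.sum_congr rfl fun n _ => hx n
    filter_upwards [hae, hcoe, ae_domDd_ne_zero ct] with x hx hx' hx0
    simp_rw [hx'] at hx
    exact tendsto_nhds_unique hx ((hK x hx0).comp (hs.comp hφ.tendsto_atTop))
  have hKm : MemLp K 2 μ := (memLp_congr_ae hKF).1 (Lp.memLp F)
  refine ⟨hKm, fun n g hg => ?_⟩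
  have hgm : MemLp (planeMode n g) 2 μ := memLp_planeMode ct n hg
  have hKF' : hKm.toLp K = F := by
    rw [← Lp.toLp_coeFn F (Lp.memLp F)]
    exact MemLp.toLp_congr _ _ hKF.symm
  rw [← inner_toLp hgm hKm, hKF']
  have h1 := hF.mapL (innerSL ℂ (hgm.toLp _))
  have h2 : HasSum (fun m => innerSL ℂ (hgm.toLp _) (v m)) (innerSL ℂ (hgm.toLp _) (v n)) := by
    refine hasSum_single n fun m hmn => ?_
    simp only [v, innerSL_apply_apply]
    rw [inner_toLp, hμ, setIntegral_conj_planeMode_mul, if_neg hmn.symm]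
  have h3 := h1.unique h2
  simp only [v, innerSL_apply_apply] at h3
  rw [h3, inner_toLp, hμ, setIntegral_conj_planeMode_mul, if_pos rfl]

theorem setIntegral_Icc_neg_eq {E : Type*} [NormedAddCommGroup E] [NormedSpace ℝ E] {a : ℝ}
    (ha : 0 ≤ a) {f : ℝ → E} (hf : Continuous f) :
    ∫ t in Set.Icc (-a) a, f t = ∫ t in (0 : ℝ)..a, (f t + f (-t)) := by
  have hi (b c : ℝ) : IntervalIntegrable f volume b c := hf.intervalIntegrable b c
  rw [integral_Icc_eq_integral_Ioc, ← intervalIntegral.integral_of_le (by linarith),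
    ← intervalIntegral.integral_add_adjacent_intervals (hi (-a) 0) (hi 0 a),
    intervalIntegral.integral_add (g := fun t => f (-t)) (hi 0 a)
      ((hf.comp continuous_neg).intervalIntegrable 0 a),
    intervalIntegral.integral_comp_neg, neg_zero, add_comm]

theorem setIntegral_exp_neg_mul_abs_le {a s : ℝ} (ha : 0 ≤ a) (hs : 0 < s) :
    ∫ t in Set.Icc (-a) a, Real.exp (-(2 * s) * |t|) ≤ 1 / s := by
  have hs' : -(2 * s) ≠ 0 := by linarith
  rw [setIntegral_Icc_neg_eq ha (by fun_prop)]
  have h : ∫ t in (0 : ℝ)..a, (Real.exp (-(2 * s) * |t|) + Real.exp (-(2 * s) * |-t|)) =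
      ∫ t in (0 : ℝ)..a, 2 * Real.exp (-(2 * s) * t) := by
    refine intervalIntegral.integral_congr fun t ht => ?_
    rw [Set.uIcc_of_le ha] at ht
    simp only [abs_neg, abs_of_nonneg ht.1]
    ring
  rw [h, intervalIntegral.integral_const_mul,
    intervalIntegral.integral_comp_mul_left (fun t => Real.exp t) hs', integral_exp]
  have h1 : 0 < Real.exp (-(2 * s) * a) := Real.exp_pos _
  rw [mul_zero, Real.exp_zero, smul_eq_mul]
  have : 2 * ((-(2 * s))⁻¹ * (Real.exp (-(2 * s) * a) - 1)) =
      (1 - Real.exp (-(2 * s) * a)) / s := by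
    field_simp
    ring
  rw [this]
  gcongr
  linarith

theorem betaCoef3_im_nonneg (k α₁ α₂ : ℝ) (n : ℤ × ℤ) : 0 ≤ (betaCoef3 k α₁ α₂ n).im := by
  unfold betaCoef3
  split_ifs <;> simp [Real.sqrt_nonneg]

theorem betaCoef3_norm_le_or_im_eq {k : ℝ} (hk : 0 ≤ k) (α₁ α₂ : ℝ) (n : ℤ × ℤ) :
    ‖betaCoef3 k α₁ α₂ n‖ ≤ k ∨ (betaCoef3 k α₁ α₂ n).im = ‖betaCoef3 k α₁ α₂ n‖ := by
  unfold betaCoef3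
  split_ifs
  · left
    rw [Complex.norm_real, Real.norm_of_nonneg (Real.sqrt_nonneg _)]
    refine Real.sqrt_le_iff.2 ⟨hk, ?_⟩
    nlinarith [sq_nonneg (α₁ + n.1), sq_nonneg (α₂ + n.2)]
  · right
    simp [abs_of_nonneg (Real.sqrt_nonneg _)]

theorem betaCoef3_norm_sq_ge (k α₁ α₂ : ℝ) (n : ℤ × ℤ) :
    (α₁ + n.1) ^ 2 + (α₂ + n.2) ^ 2 - k ^ 2 ≤ ‖betaCoef3 k α₁ α₂ n‖ ^ 2 := by
  unfold betaCoef3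
  split_ifs with h
  · nlinarith [sq_nonneg ‖((√(k ^ 2 - (α₁ + n.1) ^ 2 - (α₂ + n.2) ^ 2) : ℝ) : ℂ)‖]
  · rw [norm_mul, Complex.norm_I, one_mul, Complex.norm_real,
      Real.norm_of_nonneg (Real.sqrt_nonneg _), Real.sq_sqrt (by linarith)]

theorem exists_mul_norm_le_betaCoef3 {k b : ℝ} (hk : 0 < k) (α₁ α₂ : ℝ) (hb : 0 < b)
    (hβ : ∀ n : ℤ × ℤ, b ≤ ‖betaCoef3 k α₁ α₂ n‖) :
    ∃ B > 0, ∀ n : ℤ × ℤ, B * ‖n‖ ≤ ‖betaCoef3 k α₁ α₂ n‖ := by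
  set R := 2 * (|α₁| + |α₂|) + 4 * k with hR
  have hA1 := abs_nonneg α₁
  have hA2 := abs_nonneg α₂
  have hR0 : 0 < R := by positivity
  refine ⟨min (1 / 4) (b / R), by positivity, fun n => ?_⟩
  rcases le_total ‖n‖ R with h | h
  · calc min (1 / 4) (b / R) * ‖n‖ ≤ b / R * R := by
          gcongr
          exact min_le_right _ _
      _ = b := by field_simp
      _ ≤ _ := hβ n
  · calc min (1 / 4) (b / R) * ‖n‖ ≤ 1 / 4 * ‖n‖ := by
          gcongr
          exact min_le_left _ _
      _ ≤ _ := by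
        refine le_of_sq_le_sq ?_ (norm_nonneg _)
        refine le_trans ?_ (betaCoef3_norm_sq_ge k α₁ α₂ n)
        have key : ∀ (α : ℝ) (m : ℤ), |α| ≤ |α₁| + |α₂| → ‖n‖ = |(m : ℝ)| →
            (‖n‖ / 2) ^ 2 ≤ (α + m) ^ 2 := by
          intro α m hα hm
          rw [← sq_abs (α + m)]
          have h1 : |(m : ℝ)| - |α| ≤ |α + m| := by
            have := abs_sub_abs_le_abs_sub (m : ℝ) (-α)
            rwa [abs_neg, sub_neg_eq_add, add_comm (m : ℝ)] at this
          gcongr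
          linarith
        have hkn : 4 * k ≤ ‖n‖ := by linarith
        rcases max_choice ‖n.1‖ ‖n.2‖ with hm | hm
        · have := key α₁ n.1 (by linarith) (by rw [Prod.norm_def, hm, Int.norm_eq_abs])
          nlinarith [sq_nonneg (α₂ + n.2)]
        · have := key α₂ n.2 (by linarith) (by rw [Prod.norm_def, hm, Int.norm_eq_abs])
          nlinarith [sq_nonneg (α₁ + n.1)]

theorem summable_int_prod_norm_rpow {s : ℝ} (hs : 2 < s) :
    Summable fun n : ℤ × ℤ => ‖n‖ ^ (-s) := by
  rw [← (finTwoArrowEquiv ℤ).summable_iff]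
  refine (EisensteinSeries.summable_one_div_norm_rpow hs).congr fun n => ?_
  simp [EisensteinSeries.norm_eq_max_natAbs, Prod.norm_def, Int.norm_eq_abs]

theorem summable_inv_norm_betaCoef3_pow {k b : ℝ} (hk : 0 < k) (α₁ α₂ : ℝ) (hb : 0 < b)
    (hβ : ∀ n : ℤ × ℤ, b ≤ ‖betaCoef3 k α₁ α₂ n‖) :
    Summable fun n => (‖betaCoef3 k α₁ α₂ n‖ ^ 3)⁻¹ := by
  obtain ⟨B, hB, h⟩ := exists_mul_norm_le_betaCoef3 hk α₁ α₂ hb hβ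
  refine Summable.of_norm_bounded_eventually
    ((summable_int_prod_norm_rpow (s := 3) (by norm_num)).mul_left (B ^ 3)⁻¹) ?_
  filter_upwards [(Set.finite_singleton (0 : ℤ × ℤ)).compl_mem_cofinite] with n hn
  have hn0 : 0 < ‖n‖ := norm_pos_iff.2 hn
  rw [Real.rpow_neg hn0.le, show (3 : ℝ) = (3 : ℕ) by norm_num, Real.rpow_natCast, ← mul_inv,
    ← mul_pow, Real.norm_of_nonneg (by positivity)]
  gcongr
  exact h n

theorem norm_exp_betaCoef3 (k α₁ α₂ : ℝ) (n : ℤ × ℤ) (t : ℝ) :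
    ‖Complex.exp (I * betaCoef3 k α₁ α₂ n * t)‖ =
      Real.exp (-((betaCoef3 k α₁ α₂ n).im * t)) := by
  simp [Complex.norm_exp]

theorem norm_exp_betaCoef3_le {k : ℝ} (hk : 0 < k) (α₁ α₂ : ℝ) {n : ℤ × ℤ}
    (hn : 0 < ‖betaCoef3 k α₁ α₂ n‖) {t : ℝ} (ht : 0 < t) :
    ‖Complex.exp (I * betaCoef3 k α₁ α₂ n * t)‖ ≤
      (k ^ 2 + 2 / t ^ 2) * (‖betaCoef3 k α₁ α₂ n‖ ^ 2)⁻¹ := by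
  rw [norm_exp_betaCoef3]
  set β := betaCoef3 k α₁ α₂ n
  rw [← div_eq_mul_inv, le_div_iff₀ (by positivity)]
  rcases betaCoef3_norm_le_or_im_eq hk.le α₁ α₂ n with h | h
  · have h1 : Real.exp (-(β.im * t)) ≤ 1 := by
      have := betaCoef3_im_nonneg k α₁ α₂ n
      exact Real.exp_le_one_iff.2 (neg_nonpos.2 (by positivity))
    calc Real.exp (-(β.im * t)) * ‖β‖ ^ 2 ≤ 1 * k ^ 2 := by gcongr
      _ ≤ k ^ 2 + 2 / t ^ 2 := by
        have : 0 ≤ 2 / t ^ 2 := by positivity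
        linarith
  · rw [h, Real.exp_neg]
    have h1 := Real.pow_div_factorial_le_exp (‖β‖ * t) (by positivity) 2
    have h2 : (Real.exp (‖β‖ * t))⁻¹ * ‖β‖ ^ 2 ≤ 2 / t ^ 2 := by
      rw [inv_mul_eq_div, div_le_div_iff₀ (Real.exp_pos _) (by positivity)]
      norm_num [Nat.factorial] at h1
      nlinarith
    nlinarith [sq_nonneg k]

theorem setIntegral_norm_exp_betaCoef3_sq_le {k : ℝ} (hk : 0 < k) (α₁ α₂ : ℝ) {n : ℤ × ℤ}
    (hn : 0 < ‖betaCoef3 k α₁ α₂ n‖) {a : ℝ} (ha : 0 ≤ a) :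
    ∫ t in Set.Icc (-a) a, ‖Complex.exp (I * betaCoef3 k α₁ α₂ n * (|t| : ℝ))‖ ^ 2 ≤
      (2 * a * k + 1) * ‖betaCoef3 k α₁ α₂ n‖⁻¹ := by
  simp_rw [norm_exp_betaCoef3]
  have him := betaCoef3_im_nonneg k α₁ α₂ n
  set β := betaCoef3 k α₁ α₂ n
  rw [← div_eq_mul_inv]
  rcases betaCoef3_norm_le_or_im_eq hk.le α₁ α₂ n with h | h
  · calc ∫ t in Set.Icc (-a) a, Real.exp (-(β.im * |t|)) ^ 2
        ≤ ∫ t in Set.Icc (-a) a, (1 : ℝ) := by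
          refine setIntegral_mono (Continuous.integrableOn_Icc (by fun_prop))
            (Continuous.integrableOn_Icc (by fun_prop)) fun t => ?_
          exact pow_le_one₀ (Real.exp_pos _).le
            (Real.exp_le_one_iff.2 (neg_nonpos.2 (by positivity)))
      _ = 2 * a := by
        simp [ha]
        ring
      _ ≤ _ := by
        rw [le_div_iff₀ hn]
        nlinarith
  · have h' (t : ℝ) : Real.exp (-(β.im * |t|)) ^ 2 = Real.exp (-(2 * ‖β‖) * |t|) := by
      rw [h, ← Real.exp_nat_mul]
      congr 1
      push_cast
      ring
    simp_rw [h']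
    refine (setIntegral_exp_neg_mul_abs_le ha hn).trans ?_
    gcongr
    have : 0 ≤ 2 * a * k := by positivity
    linarith

/-- The dependence on `x₃` of the `n`-th plane-wave mode of `funKd`. -/
def kdProfile (k α₁ α₂ : ℝ) (𝒳 : ℝ → ℝ) (n : ℤ × ℤ) (t : ℝ) : ℂ :=
  I / (8 * (π : ℂ) ^ 2) * (1 / betaCoef3 k α₁ α₂ n) *
    Complex.exp (I * betaCoef3 k α₁ α₂ n * (|t| : ℝ)) * (𝒳 |t| : ℝ)

theorem continuous_kdProfile (k α₁ α₂ : ℝ) {𝒳 : ℝ → ℝ} (h𝒳 : Continuous 𝒳) (n : ℤ × ℤ) :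
    Continuous (kdProfile k α₁ α₂ 𝒳 n) := by
  unfold kdProfile
  fun_prop

theorem hasSum_planeMode_kdProfile {k b : ℝ} (hk : 0 < k) (α₁ α₂ : ℝ) (hb : 0 < b)
    (hβ : ∀ n : ℤ × ℤ, b ≤ ‖betaCoef3 k α₁ α₂ n‖) (𝒳 : ℝ → ℝ)
    {x : EuclideanSpace ℝ (Fin 3)} (hx : x 2 ≠ 0) :
    HasSum (fun n => planeMode n (kdProfile k α₁ α₂ 𝒳 n) x) (funKd k α₁ α₂ 𝒳 x) := by
  have hx' : 0 < |x 2| := abs_pos.2 hx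
  have hsum : Summable fun n => planeMode n (kdProfile k α₁ α₂ 𝒳 n) x := by
    refine Summable.of_norm_bounded ((summable_inv_norm_betaCoef3_pow hk α₁ α₂ hb hβ).mul_left
      (‖I / (8 * (π : ℂ) ^ 2)‖ * (k ^ 2 + 2 / |x 2| ^ 2) * ‖((𝒳 |x 2| : ℝ) : ℂ)‖)) fun n => ?_
    have hn : 0 < ‖betaCoef3 k α₁ α₂ n‖ := hb.trans_le (hβ n)
    rw [norm_planeMode, kdProfile, norm_mul, norm_mul, norm_mul, norm_div 1, norm_one, one_div]
    calc _ ≤ ‖I / (8 * (π : ℂ) ^ 2)‖ * ‖betaCoef3 k α₁ α₂ n‖⁻¹ *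
          ((k ^ 2 + 2 / |x 2| ^ 2) * (‖betaCoef3 k α₁ α₂ n‖ ^ 2)⁻¹) *
          ‖((𝒳 |x 2| : ℝ) : ℂ)‖ := by
          gcongr
          exact norm_exp_betaCoef3_le hk α₁ α₂ hn hx'
      _ = _ := by
        field_simp
  convert hsum.hasSum using 1
  rw [funKd, greenGd, ← tsum_mul_left, ← tsum_mul_left, ← tsum_mul_right]
  refine tsum_congr fun n => ?_
  rw [planeMode, kdProfile]
  have : Complex.exp (-I * α₁ * x 0 - I * α₂ * x 1) *
      Complex.exp (I * ((α₁ + n.1 : ℝ) : ℂ) * x 0 + I * ((α₂ + n.2 : ℝ) : ℂ) * x 1 +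
        I * betaCoef3 k α₁ α₂ n * (|x 2| : ℝ)) =
      Complex.exp (n.1 * x 0 * I) * Complex.exp (n.2 * x 1 * I) *
        Complex.exp (I * betaCoef3 k α₁ α₂ n * (|x 2| : ℝ)) := by
    rw [← Complex.exp_add, ← Complex.exp_add, ← Complex.exp_add]
    congr 1
    push_cast
    ring
  linear_combination
    (I / (8 * (π : ℂ) ^ 2) * (1 / betaCoef3 k α₁ α₂ n) * ((𝒳 |x 2| : ℝ) : ℂ)) * this

theorem summable_norm_integral_kdProfile {k b a : ℝ} (hk : 0 < k) (α₁ α₂ : ℝ) (hb : 0 < b)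
    (hβ : ∀ n : ℤ × ℤ, b ≤ ‖betaCoef3 k α₁ α₂ n‖) {𝒳 : ℝ → ℝ} (h𝒳 : Continuous 𝒳) (ha : 0 ≤ a) :
    Summable fun n => ‖∫ t in Set.Icc (-a) a,
      kdProfile k α₁ α₂ 𝒳 n t * starRingEnd ℂ (kdProfile k α₁ α₂ 𝒳 n t)‖ := by
  obtain ⟨M, hM⟩ := (isCompact_Icc (a := -a) (b := a)).exists_bound_of_continuousOn
    (f := fun t => 𝒳 |t|) (by fun_prop)
  refine Summable.of_nonneg_of_le (fun n => norm_nonneg _) (fun n => ?_)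
    ((summable_inv_norm_betaCoef3_pow hk α₁ α₂ hb hβ).mul_left
      (‖I / (8 * (π : ℂ) ^ 2)‖ ^ 2 * M ^ 2 * (2 * a * k + 1)))
  have hn : 0 < ‖betaCoef3 k α₁ α₂ n‖ := hb.trans_le (hβ n)
  have hle := setIntegral_norm_exp_betaCoef3_sq_le hk α₁ α₂ hn ha
  set β := betaCoef3 k α₁ α₂ n with hβn
  set D := ‖I / (8 * (π : ℂ) ^ 2)‖ with hD
  calc _ ≤ ∫ t in Set.Icc (-a) a,
        ‖kdProfile k α₁ α₂ 𝒳 n t * starRingEnd ℂ (kdProfile k α₁ α₂ 𝒳 n t)‖ :=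
        norm_integral_le_integral_norm _
    _ ≤ ∫ t in Set.Icc (-a) a, D ^ 2 * M ^ 2 * (‖β‖ ^ 2)⁻¹ *
          ‖Complex.exp (I * β * (|t| : ℝ))‖ ^ 2 := by
        have hc := continuous_kdProfile k α₁ α₂ h𝒳 n
        refine setIntegral_mono_on (Continuous.integrableOn_Icc ?_)
          (Continuous.integrableOn_Icc (by fun_prop)) measurableSet_Icc fun t ht => ?_
        · exact (hc.mul (Complex.continuous_conj.comp hc)).norm
        have hMt : ‖((𝒳 |t| : ℝ) : ℂ)‖ ^ 2 ≤ M ^ 2 := by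
          rw [Complex.norm_real]
          have := hM t ht
          gcongr
        rw [norm_mul, RCLike.norm_conj, ← sq, kdProfile, ← hβn, norm_mul, norm_mul, norm_mul,
          norm_div 1, norm_one, one_div, ← hD]
        calc _ = D ^ 2 * (‖β‖ ^ 2)⁻¹ * ‖Complex.exp (I * β * (|t| : ℝ))‖ ^ 2 *
              ‖((𝒳 |t| : ℝ) : ℂ)‖ ^ 2 := by
              rw [mul_pow, mul_pow, mul_pow, inv_pow]
          _ ≤ D ^ 2 * (‖β‖ ^ 2)⁻¹ * ‖Complex.exp (I * β * (|t| : ℝ))‖ ^ 2 * M ^ 2 := by gcongr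
          _ = _ := by ring
    _ ≤ D ^ 2 * M ^ 2 * (‖β‖ ^ 2)⁻¹ * ((2 * a * k + 1) * ‖β‖⁻¹) := by
        rw [integral_const_mul]
        gcongr
    _ = _ := by
        field_simp

/-- K_d is integrable on D_{dc̃} and
K̂_{dj} = (i/(2√(8π²c̃))) (1/β_{j₁,j₂}) ∫₀^{c̃} [e^{i(β_{j₁,j₂}−j₃π/c̃)x₃} +
e^{i(β_{j₁,j₂}+j₃π/c̃)x₃}] 𝒳(x₃) dx₃. -/
theorem statement11 (k α₁ α₂ c ct : ℝ) (hk : 0 < k) (hc : 0 < c) (hcct : c < ct)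
    (b : ℝ) (hb : 0 < b) (hβ : ∀ n : ℤ × ℤ, b ≤ ‖betaCoef3 k α₁ α₂ n‖)
    (𝒳 : ℝ → ℝ) (h𝒳 : ContDiff ℝ (⊤ : ℕ∞) 𝒳)
    (h𝒳1 : ∀ t : ℝ, |t| ≤ c → 𝒳 t = 1)
    (h𝒳0 : ∀ t : ℝ, (c + ct) / 2 ≤ |t| → 𝒳 t = 0) :
    IntegrableOn (funKd k α₁ α₂ 𝒳) (domDd ct) volume ∧
      ∀ j : ℤ × ℤ × ℤ,
        fourierCoef3 ct (funKd k α₁ α₂ 𝒳) j =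
          (Complex.I / (2 * (Real.sqrt (8 * π ^ 2 * ct) : ℂ))) *
            (1 / betaCoef3 k α₁ α₂ (j.1, j.2.1)) *
            ∫ t in (0 : ℝ)..ct,
              (Complex.exp (Complex.I *
                  (betaCoef3 k α₁ α₂ (j.1, j.2.1) - (j.2.2 : ℂ) * (π : ℂ) / (ct : ℂ)) * (t : ℂ)) +
                Complex.exp (Complex.I *
                  (betaCoef3 k α₁ α₂ (j.1, j.2.1) + (j.2.2 : ℂ) * (π : ℂ) / (ct : ℂ)) * (t : ℂ))) *
                ((𝒳 t : ℝ) : ℂ) := by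
  have hct : 0 < ct := hc.trans hcct
  obtain ⟨hKm, hKint⟩ := planeMode_series ct
    (continuous_kdProfile k α₁ α₂ h𝒳.continuous)
    (summable_norm_integral_kdProfile hk α₁ α₂ hb hβ h𝒳.continuous hct.le)
    fun x hx => hasSum_planeMode_kdProfile hk α₁ α₂ hb hβ 𝒳 hx
  refine ⟨hKm.integrable one_le_two, fun ⟨j₁, j₂, j₃⟩ => ?_⟩
  set β := betaCoef3 k α₁ α₂ (j₁, j₂) with hβj
  set w : ℂ := (Real.sqrt (8 * π ^ 2 * ct) : ℂ) with hw
  let g (t : ℝ) : ℂ := 1 / w * Complex.exp (I * (j₃ * π / ct) * t)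
  have hg : Continuous g := by fun_prop
  have hφ (x : EuclideanSpace ℝ (Fin 3)) :
      fBasis3 ct (-(j₁, j₂, j₃)) x = starRingEnd ℂ (planeMode (j₁, j₂) g x) := by
    simp only [fBasis3, planeMode, g, map_mul, map_div₀, map_one, ← Complex.exp_conj,
      Complex.conj_I, Complex.conj_ofReal, map_intCast, hw, Prod.fst_neg, Prod.snd_neg]
    rw [mul_left_comm, ← Complex.exp_add, ← Complex.exp_add]
    push_cast
    congr 2
    ring
  have hgconj (t : ℝ) :
      starRingEnd ℂ (g t) = 1 / w * Complex.exp (-(I * (j₃ * π / ct) * t)) := by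
    simp only [g, map_mul, map_div₀, map_one, ← Complex.exp_conj,
      Complex.conj_I, Complex.conj_ofReal, map_intCast, hw, neg_mul]
  have hfold : ∫ t in Set.Icc (-ct) ct, kdProfile k α₁ α₂ 𝒳 (j₁, j₂) t * starRingEnd ℂ (g t) =
      I / (8 * (π : ℂ) ^ 2) * (1 / β) * (1 / w) * ∫ t in (0 : ℝ)..ct,
        (Complex.exp (I * (β - j₃ * π / ct) * t) + Complex.exp (I * (β + j₃ * π / ct) * t)) *
          ((𝒳 t : ℝ) : ℂ) := by
    have hcont : Continuous fun t => kdProfile k α₁ α₂ 𝒳 (j₁, j₂) t * starRingEnd ℂ (g t) :=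
      (continuous_kdProfile k α₁ α₂ h𝒳.continuous _).mul (Complex.continuous_conj.comp hg)
    rw [setIntegral_Icc_neg_eq hct.le hcont, ← intervalIntegral.integral_const_mul]
    refine intervalIntegral.integral_congr fun t ht => ?_
    rw [Set.uIcc_of_le hct.le] at ht
    have h1 : Complex.exp (I * (β - j₃ * π / ct) * t) =
        Complex.exp (I * β * t) * Complex.exp (-(I * (j₃ * π / ct) * t)) := by
      rw [← Complex.exp_add]
      congr 1
      ring
    have h2 : Complex.exp (I * (β + j₃ * π / ct) * t) =
        Complex.exp (I * β * t) * Complex.exp (I * (j₃ * π / ct) * t) := by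
      rw [← Complex.exp_add]
      congr 1
      ring
    simp only [hgconj, kdProfile, abs_neg, abs_of_nonneg ht.1, ← hβj, Complex.ofReal_neg, mul_neg,
      neg_neg, h1, h2]
    ring
  simp only [fourierCoef3, hφ]
  rw [hKint _ g hg, hfold]
  have hπ : (π : ℂ) ≠ 0 := Complex.ofReal_ne_zero.2 Real.pi_ne_zero
  rw [← mul_assoc]
  congr 1
  rw [div_mul_eq_mul_div, div_mul_eq_mul_div, div_mul_eq_mul_div, mul_div_assoc']
  have hw0 : w ≠ 0 := by
    rw [hw, Complex.ofReal_ne_zero, Real.sqrt_ne_zero']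
    positivity
  field_simp
  ring

end
end

section
/- For every j = (j₁,j₂,j₃) ∈ ℤ³ with (α₁+j₁)² + (α₂+j₂)² + (j₃π/c̃)² ≠ k², the Fourier coefficient of F satisfies F̂_j = (1/√(8π²c̃)) · (1/((α₁+j₁)² + (α₂+j₂)² + (j₃π/c̃)² − k²)) · [ 1 − ∫_{D_{dc̃}} (e^{ik|x|}/(4π|x|)) ( 2ik 𝒴_ε′(|x|) + 𝒴_ε″(|x|) ) e^{−i(α_{1,j₁}x₁ + α_{2,j₂}x₂ + j₃πx₃/c̃)} dx ]. -/
open MeasureTheory Complex Real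

noncomputable section

/-- F(x) = e^{−iα₁x₁−iα₂x₂} (e^{ik|x|}/(4π|x|)) 𝒴_ε(|x|). -/
def funF3 (k α₁ α₂ : ℝ) (𝒴 : ℝ → ℝ) (x : EuclideanSpace ℝ (Fin 3)) : ℂ :=
  Complex.exp (-Complex.I * (α₁ : ℂ) * (x 0 : ℂ) - Complex.I * (α₂ : ℂ) * (x 1 : ℂ)) *
    (Complex.exp (Complex.I * (k : ℂ) * (‖x‖ : ℂ)) / (4 * (π : ℂ) * (‖x‖ : ℂ))) *
    ((𝒴 ‖x‖ : ℝ) : ℂ)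

local notation "E3" => EuclideanSpace ℝ (Fin 3)

theorem integrable_radial_div_norm_mul_exp {h : ℝ → ℂ} (hcont : Continuous h) {R : ℝ}
    (hR : ∀ t, R ≤ t → h t = 0) (ξ : E3) :
    Integrable fun x : E3 => h ‖x‖ / ‖x‖ * cexp (-I * (inner ℝ ξ x : ℝ)) := by
  have hrad : Integrable fun x : E3 => h ‖x‖ / ‖x‖ := by
    refine (integrable_fun_norm_addHaar (E := E3) volume (f := fun t => h t / t)).2 ?_
    have hsupp : HasCompactSupport fun t : ℝ => (max t 0 : ℝ) • h (max t 0) := by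
      refine HasCompactSupport.intro (isCompact_Icc (a := 0) (b := R)) fun t ht => ?_
      rcases le_total t 0 with h0 | h0
      · simp [h0]
      · rw [Set.mem_Icc, not_and, not_le] at ht
        simp [h0, hR t (ht h0).le]
    have hint : Integrable fun t : ℝ => (max t 0 : ℝ) • h (max t 0) :=
      Continuous.integrable_of_hasCompactSupport (by fun_prop) hsupp
    refine hint.integrableOn.congr_fun (fun t ht => ?_) measurableSet_Ioi
    have ht : 0 < t := ht
    have ht' : (t : ℂ) ≠ 0 := by exact_mod_cast ht.ne'
    simp only [max_eq_left ht.le, finrank_euclideanSpace_fin, real_smul]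
    push_cast
    field_simp
  refine hrad.mul_bdd (c := 1) (by fun_prop) (.of_forall fun x => ?_)
  rw [show -I * ((inner ℝ ξ x : ℝ) : ℂ) = ((-inner ℝ ξ x : ℝ) : ℂ) * I by push_cast; ring,
    norm_exp_ofReal_mul_I]

theorem exists_linearIsometryEquiv_apply_eq (ξ : E3) :
    ∃ T : E3 ≃ₗᵢ[ℝ] WithLp 2 (ℝ × ℂ), T ξ = WithLp.toLp 2 (‖ξ‖, 0) := by
  have hfin : Module.finrank ℝ (WithLp 2 (ℝ × ℂ)) = 3 := by
    rw [(WithLp.linearEquiv 2 ℝ (ℝ × ℂ)).finrank_eq, Module.finrank_prod]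
    simp
  let A : E3 ≃ₗᵢ[ℝ] WithLp 2 (ℝ × ℂ) :=
    ((stdOrthonormalBasis ℝ (WithLp 2 (ℝ × ℂ))).reindex (finCongr hfin)).repr.symm
  refine ⟨A.trans (ℝ ∙ (A ξ - WithLp.toLp 2 (‖ξ‖, 0)))ᗮ.reflection, ?_⟩
  rw [LinearIsometryEquiv.trans_apply, Submodule.reflection_sub]
  rw [A.norm_map, WithLp.prod_norm_eq_of_L2]
  simp

theorem integral_comp_norm_div_norm_complex {h G : ℝ → ℂ} (hcont : Continuous h) {R : ℝ}
    (hR : ∀ t, R ≤ t → h t = 0) (hG : ∀ t, HasDerivAt G (-h t) t)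
    (hGR : ∀ t, R ≤ t → G t = 0) {z : ℝ} (hz : z ≠ 0) :
    ∫ w : ℂ, h √(z ^ 2 + ‖w‖ ^ 2) / √(z ^ 2 + ‖w‖ ^ 2) = 2 * π * G |z| := by
  rw [integral_fun_norm_addHaar (volume : Measure ℂ)
    fun t => h √(z ^ 2 + t ^ 2) / (√(z ^ 2 + t ^ 2) : ℝ)]
  have hpos (t : ℝ) : 0 < z ^ 2 + t ^ 2 := by positivity
  have hne (t : ℝ) : ((√(z ^ 2 + t ^ 2) : ℝ) : ℂ) ≠ 0 := by
    exact_mod_cast (Real.sqrt_pos.2 (hpos t)).ne'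
  have hbig {t : ℝ} (ht : |R| ≤ t) : R ≤ √(z ^ 2 + t ^ 2) :=
    (le_abs_self R).trans (ht.trans (Real.le_sqrt_of_sq_le (by nlinarith)))
  have hderiv (t : ℝ) : HasDerivAt (fun t => -G √(z ^ 2 + t ^ 2))
      (t • (h √(z ^ 2 + t ^ 2) / (√(z ^ 2 + t ^ 2) : ℝ))) t := by
    have h1 : HasDerivAt (fun t : ℝ => √(z ^ 2 + t ^ 2)) (t / √(z ^ 2 + t ^ 2)) t := by
      refine (((hasDerivAt_pow 2 t).const_add (z ^ 2)).sqrt (hpos t).ne').congr_deriv ?_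
      simp
      field_simp
    refine ((hG _).scomp t h1).neg.congr_deriv ?_
    simp only [real_smul]
    push_cast
    ring
  have hcont' : Continuous fun t : ℝ => t • (h √(z ^ 2 + t ^ 2) / (√(z ^ 2 + t ^ 2) : ℝ)) := by
    refine continuous_id.smul (Continuous.div (by fun_prop) (by fun_prop) hne)
  have hint : Integrable fun t : ℝ => t • (h √(z ^ 2 + t ^ 2) / (√(z ^ 2 + t ^ 2) : ℝ)) := by
    refine hcont'.integrable_of_hasCompactSupport
      (HasCompactSupport.intro (isCompact_Icc (a := -|R|) (b := |R|)) fun t ht => ?_)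
    have : |R| ≤ |t| := by
      rw [Set.mem_Icc, ← abs_le, not_le] at ht
      exact ht.le
    have := hbig this
    rw [sq_abs] at this
    simp [hR _ this]
  have hlim : Filter.Tendsto (fun t => -G √(z ^ 2 + t ^ 2)) Filter.atTop (nhds 0) := by
    refine tendsto_const_nhds.congr' ?_
    filter_upwards [Filter.eventually_ge_atTop |R|] with t ht
    simp [hGR _ (hbig ht)]
  have key := integral_Ioi_of_hasDerivAt_of_tendsto' (a := 0) (fun t _ => hderiv t)
    hint.integrableOn hlim
  have hvol : (volume : Measure ℂ).real (Metric.ball 0 1) = π := by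
    simp [Measure.real, Complex.volume_ball]
  simp only [Complex.finrank_real_complex, Nat.add_one_sub_one, pow_one, hvol]
  rw [key]
  simp [Real.sqrt_sq_eq_abs, mul_assoc]

theorem integral_radial_div_norm_mul_exp {h G : ℝ → ℂ} (hcont : Continuous h) {R : ℝ}
    (hR : ∀ t, R ≤ t → h t = 0) (hG : ∀ t, HasDerivAt G (-h t) t)
    (hGR : ∀ t, R ≤ t → G t = 0) (ξ : E3) :
    ∫ x : E3, h ‖x‖ / ‖x‖ * cexp (-I * (inner ℝ ξ x : ℝ)) =
      2 * π * ∫ z : ℝ, G |z| * cexp (-I * ‖ξ‖ * z) := by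
  obtain ⟨T, hT⟩ := exists_linearIsometryEquiv_apply_eq ξ
  let g : ℝ × ℂ → ℂ := fun p =>
    h √(p.1 ^ 2 + ‖p.2‖ ^ 2) / √(p.1 ^ 2 + ‖p.2‖ ^ 2) * cexp (-I * ‖ξ‖ * p.1)
  have hpres : MeasurePreserving (T.toMeasurableEquiv.trans (MeasurableEquiv.toLp 2 (ℝ × ℂ)).symm)
      volume volume :=
    (WithLp.volume_preserving_symm_measurableEquiv_toLp_prod ℝ ℂ).comp T.measurePreserving
  have hg (x : E3) : h ‖x‖ / ‖x‖ * cexp (-I * (inner ℝ ξ x : ℝ)) =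
      g (T.toMeasurableEquiv.trans (MeasurableEquiv.toLp 2 (ℝ × ℂ)).symm x) := by
    have hnorm : ‖x‖ = √((T x).fst ^ 2 + ‖(T x).snd‖ ^ 2) := by
      rw [← T.norm_map, WithLp.prod_norm_eq_of_L2]
      simp
    have hinner : inner ℝ ξ x = ‖ξ‖ * (T x).fst := by
      rw [← T.inner_map_map, hT, WithLp.prod_inner_apply]
      simp [mul_comm]
    simp only [g]
    rw [hinner, hnorm]
    push_cast
    rw [← mul_assoc]
    rfl
  have hint : Integrable g := by
    rw [← hpres.integrable_comp_emb (MeasurableEquiv.measurableEmbedding _)]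
    exact (integrable_radial_div_norm_mul_exp hcont hR ξ).congr (.of_forall hg)
  simp_rw [hg]
  rw [hpres.integral_comp', Measure.volume_eq_prod, integral_prod _ hint, ← integral_const_mul]
  refine integral_congr_ae ?_
  filter_upwards [Measure.ae_ne volume (0 : ℝ)] with z hz
  simp only [g]
  rw [integral_mul_const, integral_comp_norm_div_norm_complex hcont hR hG hGR hz, mul_assoc]

theorem integral_abs_mul_exp_by_parts {h h' G : ℝ → ℂ} (hh : ∀ t, HasDerivAt h (h' t) t)
    (hcont' : Continuous h') {R : ℝ} (hR : ∀ t, R ≤ t → h t = 0) (hR' : ∀ t, R ≤ t → h' t = 0)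
    (hG : ∀ t, HasDerivAt G (-h t) t) (hGR : ∀ t, R ≤ t → G t = 0) (s : ℝ) :
    (∫ z : ℝ, -h' |z| * cexp (-I * s * z)) + s ^ 2 * ∫ z : ℝ, G |z| * cexp (-I * s * z) =
      2 * h 0 := by
  have hcontG : Continuous G := continuous_iff_continuousAt.2 fun t => (hG t).continuousAt
  have hint {φ : ℝ → ℂ} (hφ : Continuous φ) (hφR : ∀ t, R ≤ t → φ t = 0) :
      Integrable fun z : ℝ => φ |z| * cexp (-I * s * z) := by
    refine Continuous.integrable_of_hasCompactSupport (by fun_prop)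
      (HasCompactSupport.intro (isCompact_Icc (a := -R) (b := R)) fun t ht => ?_)
    rw [Set.mem_Icc, ← abs_le, not_le] at ht
    simp [hφR _ ht.le]
  let e : ℝ → ℂ := fun z => cexp (-I * s * z) + cexp (I * s * z)
  let e' : ℝ → ℂ := fun z => -I * s * cexp (-I * s * z) + I * s * cexp (I * s * z)
  have hexp (a : ℂ) (z : ℝ) :
      HasDerivAt (fun z : ℝ => cexp (a * z)) (a * cexp (a * z)) z := by
    have := ((hasDerivAt_id z).ofReal_comp.const_mul a).cexp
    simpa [mul_comm] using this
  have he (z : ℝ) : HasDerivAt e (e' z) z := (hexp _ z).add (hexp _ z)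
  have he' (z : ℝ) : HasDerivAt e' (-(s : ℂ) ^ 2 * e z) z := by
    refine (((hexp (-I * s) z).const_mul (-I * s)).add
      ((hexp (I * s) z).const_mul (I * s))).congr_deriv ?_
    simp only [e]
    linear_combination (s ^ 2 * (cexp (-I * s * z) + cexp (I * s * z))) * I_sq
  let f : ℝ → ℂ := fun z => (-h' |z| + s ^ 2 * G |z|) * cexp (-I * s * z)
  have hf : Integrable f :=
    hint (φ := fun t => -h' t + s ^ 2 * G t) (by fun_prop) fun t ht => by simp [hR' t ht, hGR t ht]
  have hsum : (∫ z : ℝ, -h' |z| * cexp (-I * s * z)) +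
      s ^ 2 * ∫ z : ℝ, G |z| * cexp (-I * s * z) = ∫ z, f z := by
    rw [← integral_const_mul, ← integral_add (hint (φ := fun t => -h' t) (by fun_prop)
      fun t ht => by simp [hR' t ht]) ((hint hcontG hGR).const_mul _)]
    congr 1 with z
    simp only [f]
    ring
  have hfneg : Integrable fun z => f (-z) := hf.comp_neg
  have hfold : ∫ z, f z = ∫ z in Set.Ioi 0, (f z + f (-z)) := by
    rw [integral_add hf.integrableOn hfneg.integrableOn, integral_comp_neg_Ioi, neg_zero,
      ← intervalIntegral.integral_Iic_add_Ioi hf.integrableOn hf.integrableOn (b := 0), add_comm]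
  have hderiv (z : ℝ) (hz : z ∈ Set.Ioi 0) :
      HasDerivAt (fun z => -h z * e z - G z * e' z) (f z + f (-z)) z := by
    have hz : 0 < z := hz
    refine (((hh z).neg.mul (he z)).sub ((hG z).mul (he' z))).congr_deriv ?_
    simp only [f, abs_neg, abs_of_pos hz, e, Pi.neg_apply]
    push_cast
    rw [show -I * s * -(z : ℂ) = I * s * z by ring]
    ring
  have hlim : Filter.Tendsto (fun z => -h z * e z - G z * e' z) Filter.atTop (nhds 0) := by
    refine tendsto_const_nhds.congr' ?_
    filter_upwards [Filter.eventually_ge_atTop R] with t ht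
    simp [hR t ht, hGR t ht]
  have key := integral_Ioi_of_hasDerivAt_of_tendsto (a := 0)
    ((((hh 0).neg.mul (he 0)).sub ((hG 0).mul (he' 0))).continuousAt.continuousWithinAt)
    hderiv (hf.add hfneg).integrableOn hlim
  rw [hsum, hfold]
  refine key.trans ?_
  simp [e, e']
  ring

/-- The distributional identity `Δ (h / |x|) = h'' / |x| - 4π h(0) δ` on the Fourier side. -/
theorem integral_deriv_radial_div_norm_mul_exp {h h' h'' : ℝ → ℂ}
    (hh : ∀ t, HasDerivAt h (h' t) t) (hh' : ∀ t, HasDerivAt h' (h'' t) t)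
    (hcont'' : Continuous h'') {R : ℝ} (hR : ∀ t, R ≤ t → h t = 0)
    (hR' : ∀ t, R ≤ t → h' t = 0) (hR'' : ∀ t, R ≤ t → h'' t = 0) (ξ : E3) :
    (∫ x : E3, h'' ‖x‖ / ‖x‖ * cexp (-I * (inner ℝ ξ x : ℝ))) +
      ‖ξ‖ ^ 2 * ∫ x : E3, h ‖x‖ / ‖x‖ * cexp (-I * (inner ℝ ξ x : ℝ)) = 4 * π * h 0 := by
  have hcont : Continuous h := continuous_iff_continuousAt.2 fun t => (hh t).continuousAt
  have hcont' : Continuous h' := continuous_iff_continuousAt.2 fun t => (hh' t).continuousAt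
  let G : ℝ → ℂ := fun t => ∫ r in t..R, h r
  have hG (t : ℝ) : HasDerivAt G (-h t) t :=
    intervalIntegral.integral_hasDerivAt_left (hcont.intervalIntegrable _ _)
      hcont.stronglyMeasurable.stronglyMeasurableAtFilter hcont.continuousAt
  have hGR (t : ℝ) (ht : R ≤ t) : G t = 0 := by
    refine intervalIntegral.integral_zero_ae (.of_forall fun r hr => hR r ?_)
    rw [Set.uIoc_of_ge ht] at hr
    exact hr.1.le
  rw [integral_radial_div_norm_mul_exp hcont'' hR'' (fun t => (hh' t).neg)
      (fun t ht => by simp [hR' t ht]) ξ, integral_radial_div_norm_mul_exp hcont hR hG hGR ξ]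
  have := integral_abs_mul_exp_by_parts hh hcont' hR hR' hG hGR ‖ξ‖
  simp only [Pi.neg_apply]
  linear_combination 2 * (π : ℂ) * this

theorem lt_norm_of_notMem_domDd {ct ε : ℝ} (hε : ε < min 1 ct / 2) {x : E3}
    (hx : x ∉ domDd ct) : 2 * ε < ‖x‖ := by
  have h1 : 2 * ε < 1 := by linarith [min_le_left 1 ct]
  have h2 : 2 * ε < ct := by linarith [min_le_right 1 ct]
  have h3 := Real.pi_gt_three
  contrapose! hx
  have hi (i : Fin 3) : |x i| ≤ 2 * ε := (PiLp.norm_apply_le x i).trans hx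
  simp only [domDd, Set.mem_ofPred_eq, Set.mem_Icc, ← abs_le]
  exact ⟨by linarith [hi 0], by linarith [hi 1], by linarith [hi 2]⟩

/-- The modulated cutoff `e^{ikt} y(t) / (4π)`. -/
def waveCutoff (k : ℝ) (y : ℝ → ℂ) (t : ℝ) : ℂ := cexp (I * k * t) * y t / (4 * π)

theorem hasDerivAt_waveCutoff (k : ℝ) {y y' : ℝ → ℂ} (hy : ∀ t, HasDerivAt y (y' t) t) (t : ℝ) :
    HasDerivAt (waveCutoff k y) (waveCutoff k (fun t => I * k * y t + y' t) t) t := by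
  have hexp : HasDerivAt (fun t : ℝ => cexp (I * k * t)) (I * k * cexp (I * k * t)) t := by
    have := ((hasDerivAt_id t).ofReal_comp.const_mul (I * k)).cexp
    simpa [mul_comm] using this
  refine ((hexp.mul (hy t)).div_const (4 * π : ℂ)).congr_deriv ?_
  simp only [waveCutoff]
  ring

/-- For (α₁+j₁)² + (α₂+j₂)² + (j₃π/c̃)² ≠ k²,
F̂_j = (1/√(8π²c̃)) (1/((α₁+j₁)²+(α₂+j₂)²+(j₃π/c̃)²−k²))
  [1 − ∫_{D_{dc̃}} (e^{ik|x|}/(4π|x|)) (2ik𝒴_ε′(|x|)+𝒴_ε″(|x|))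
       e^{−i(α_{1,j₁}x₁+α_{2,j₂}x₂+j₃πx₃/c̃)} dx]. -/
theorem statement13 (k α₁ α₂ c ct ε : ℝ) (hk : 0 < k) (hc : 0 < c) (hcct : c < ct)
    (hε : 0 < ε) (hε' : ε < min 1 ct / 2)
    (𝒴 : ℝ → ℝ) (h𝒴 : ContDiff ℝ (⊤ : ℕ∞) 𝒴)
    (h𝒴1 : ∀ t : ℝ, t ≤ ε → 𝒴 t = 1)
    (h𝒴0 : ∀ t : ℝ, 2 * ε ≤ t → 𝒴 t = 0)
    (j : ℤ × ℤ × ℤ)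
    (hj : (α₁ + (j.1 : ℝ)) ^ 2 + (α₂ + (j.2.1 : ℝ)) ^ 2 + ((j.2.2 : ℝ) * π / ct) ^ 2 ≠ k ^ 2) :
    fourierCoef3 ct (funF3 k α₁ α₂ 𝒴) j =
      ((1 : ℂ) / (Real.sqrt (8 * π ^ 2 * ct) : ℂ)) *
        ((1 : ℂ) / (((α₁ + (j.1 : ℝ)) ^ 2 + (α₂ + (j.2.1 : ℝ)) ^ 2 +
            ((j.2.2 : ℝ) * π / ct) ^ 2 - k ^ 2 : ℝ) : ℂ)) *
        (1 - ∫ x in domDd ct,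
          (Complex.exp (Complex.I * (k : ℂ) * (‖x‖ : ℂ)) / (4 * (π : ℂ) * (‖x‖ : ℂ))) *
            (2 * Complex.I * (k : ℂ) * ((deriv 𝒴 ‖x‖ : ℝ) : ℂ) +
              ((deriv (deriv 𝒴) ‖x‖ : ℝ) : ℂ)) *
            Complex.exp (-Complex.I * (((α₁ + (j.1 : ℝ)) : ℝ) * (x 0) +
                ((α₂ + (j.2.1 : ℝ)) : ℝ) * (x 1) + ((j.2.2 : ℝ) * π / ct : ℝ) * (x 2) : ℝ))) := by
  set ξ : E3 := !₂[α₁ + j.1, α₂ + j.2.1, j.2.2 * π / ct] with hξ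
  have hinner (x : E3) : inner ℝ ξ x =
      (α₁ + j.1) * x 0 + (α₂ + j.2.1) * x 1 + j.2.2 * π / ct * x 2 := by
    simp [hξ, PiLp.inner_apply, Fin.sum_univ_three]
    ring
  have hnorm : ‖ξ‖ ^ 2 = (α₁ + j.1) ^ 2 + (α₂ + j.2.1) ^ 2 + (j.2.2 * π / ct) ^ 2 := by
    simp [hξ, EuclideanSpace.norm_sq_eq, Fin.sum_univ_three]
  have hsmooth' : ContDiff ℝ (⊤ : ℕ∞) (deriv 𝒴) := by
    simpa using h𝒴.iterate_deriv 1
  have hsmooth'' : ContDiff ℝ (⊤ : ℕ∞) (deriv (deriv 𝒴)) := by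
    simpa using hsmooth'.iterate_deriv 1
  have hzero' (t : ℝ) (ht : 2 * ε < t) : deriv 𝒴 t = 0 := by
    have : 𝒴 =ᶠ[nhds t] fun _ => 0 := by
      filter_upwards [eventually_gt_nhds ht] with u hu using h𝒴0 u hu.le
    simp [this.deriv_eq]
  have hzero'' (t : ℝ) (ht : 2 * ε < t) : deriv (deriv 𝒴) t = 0 := by
    have : deriv 𝒴 =ᶠ[nhds t] fun _ => 0 := by
      filter_upwards [eventually_gt_nhds ht] with u hu using hzero' u hu
    simp [this.deriv_eq]
  let y : ℝ → ℂ := fun t => 𝒴 t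
  let y' : ℝ → ℂ := fun t => (deriv 𝒴 t : ℝ)
  let y'' : ℝ → ℂ := fun t => (deriv (deriv 𝒴) t : ℝ)
  have hy (t : ℝ) : HasDerivAt y (y' t) t :=
    ((h𝒴.differentiable (by simp)) t).hasDerivAt.ofReal_comp
  have hy' (t : ℝ) : HasDerivAt y' (y'' t) t :=
    ((hsmooth'.differentiable (by simp)) t).hasDerivAt.ofReal_comp
  have hcy : Continuous y := continuous_ofReal.comp h𝒴.continuous
  have hcy' : Continuous y' := continuous_ofReal.comp hsmooth'.continuous
  have hcy'' : Continuous y'' := continuous_ofReal.comp hsmooth''.continuous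
  have hR (t : ℝ) (ht : 2 * ε < t) : y t = 0 := by simp [y, h𝒴0 t ht.le]
  have hR' (t : ℝ) (ht : 2 * ε < t) : y' t = 0 := by simp [y', hzero' t ht]
  have hR'' (t : ℝ) (ht : 2 * ε < t) : y'' t = 0 := by simp [y'', hzero'' t ht]
  have hlt {t : ℝ} (ht : 3 * ε ≤ t) : 2 * ε < t := by linarith
  let r : ℝ → ℂ := fun t => 2 * I * k * y' t + y'' t
  have hyik (t : ℝ) : HasDerivAt (fun t => I * k * y t + y' t) (I * k * y' t + y'' t) t :=
    ((hy t).const_mul _).add (hy' t)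
  have hcontr : Continuous (waveCutoff k r) := by
    unfold waveCutoff
    fun_prop
  have hcont0 : Continuous (waveCutoff k y) := by
    unfold waveCutoff
    fun_prop
  have hr0 (t : ℝ) (ht : 2 * ε < t) : waveCutoff k r t = 0 := by
    simp [waveCutoff, r, hR' t ht, hR'' t ht]
  have hy0 (t : ℝ) (ht : 2 * ε < t) : waveCutoff k y t = 0 := by
    simp [waveCutoff, hR t ht]
  have key := integral_deriv_radial_div_norm_mul_exp (hasDerivAt_waveCutoff k hy)
    (hasDerivAt_waveCutoff k hyik) (by unfold waveCutoff; fun_prop) (R := 3 * ε)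
    (fun t ht => hy0 t (hlt ht))
    (fun t ht => by simp [waveCutoff, hR t (hlt ht), hR' t (hlt ht)])
    (fun t ht => by simp [waveCutoff, hR t (hlt ht), hR' t (hlt ht), hR'' t (hlt ht)]) ξ
  have hsplit (x : E3) :
      waveCutoff k (fun t => I * k * (I * k * y t + y' t) + (I * k * y' t + y'' t)) ‖x‖ / ‖x‖ *
        cexp (-I * (inner ℝ ξ x : ℝ)) =
      waveCutoff k r ‖x‖ / ‖x‖ * cexp (-I * (inner ℝ ξ x : ℝ)) -
        k ^ 2 * (waveCutoff k y ‖x‖ / ‖x‖ * cexp (-I * (inner ℝ ξ x : ℝ))) := by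
    simp only [waveCutoff, r]
    linear_combination (k ^ 2 * cexp (I * k * ‖x‖) * y ‖x‖ / (4 * π) / ‖x‖ *
      cexp (-I * (inner ℝ ξ x : ℝ))) * I_sq
  have hy00 : 4 * π * waveCutoff k y 0 = 1 := by
    have hπ : (π : ℂ) ≠ 0 := by exact_mod_cast Real.pi_ne_zero
    simp [waveCutoff, y, h𝒴1 0 hε.le]
    field_simp
  simp_rw [hsplit] at key
  rw [integral_sub (integrable_radial_div_norm_mul_exp hcontr (fun t ht => hr0 t (hlt ht)) ξ)
    ((integrable_radial_div_norm_mul_exp hcont0 (fun t ht => hy0 t (hlt ht)) ξ).const_mul _),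
    integral_const_mul, hy00, ← ofReal_pow ‖ξ‖, hnorm] at key
  have hleft : fourierCoef3 ct (funF3 k α₁ α₂ 𝒴) j = 1 / (√(8 * π ^ 2 * ct) : ℂ) *
      ∫ x : E3, waveCutoff k y ‖x‖ / ‖x‖ * cexp (-I * (inner ℝ ξ x : ℝ)) := by
    rw [fourierCoef3, ← integral_const_mul, setIntegral_eq_integral_of_forall_compl_eq_zero]
    · congr 1 with x
      simp only [funF3, fBasis3, waveCutoff, y, hinner]
      have hexp : cexp (-I * ((((α₁ + j.1) * x 0 + (α₂ + j.2.1) * x 1 +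
            j.2.2 * π / ct * x 2 : ℝ)) : ℂ)) =
          cexp (-I * α₁ * x 0 - I * α₂ * x 1) *
            cexp (I * (((-j).1 : ℂ) * x 0 + ((-j).2.1 : ℂ) * x 1 + ((-j).2.2 : ℂ) * π * x 2 / ct)) := by
        rw [← Complex.exp_add]
        congr 1
        simp only [Prod.fst_neg, Prod.snd_neg]
        push_cast
        ring
      rw [hexp]
      push_cast
      ring
    · intro x hx
      simp [funF3, h𝒴0 _ (lt_norm_of_notMem_domDd hε' hx).le]
  have hright : ∫ x in domDd ct,
        (cexp (I * k * ‖x‖) / (4 * π * ‖x‖)) *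
          (2 * I * k * (deriv 𝒴 ‖x‖ : ℝ) + (deriv (deriv 𝒴) ‖x‖ : ℝ)) *
          cexp (-I * ((α₁ + j.1) * x 0 + (α₂ + j.2.1) * x 1 + j.2.2 * π / ct * x 2 : ℝ)) =
      ∫ x : E3, waveCutoff k r ‖x‖ / ‖x‖ * cexp (-I * (inner ℝ ξ x : ℝ)) := by
    rw [setIntegral_eq_integral_of_forall_compl_eq_zero]
    · congr 1 with x
      simp only [waveCutoff, r, y', y'', hinner]
      ring
    · intro x hx
      have := lt_norm_of_notMem_domDd hε' hx
      simp [hzero' _ this, hzero'' _ this]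
  have hden : (((α₁ + j.1) ^ 2 + (α₂ + j.2.1) ^ 2 + (j.2.2 * π / ct) ^ 2 - k ^ 2 : ℝ) : ℂ) ≠ 0 :=
    ofReal_ne_zero.2 (sub_ne_zero.2 hj)
  rw [hleft, hright, mul_assoc (1 / (√(8 * π ^ 2 * ct) : ℂ))]
  congr 1
  rw [one_div_mul_eq_div, eq_div_iff hden]
  push_cast at key ⊢
  linear_combination key

end
end
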